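/- Let f ∈ C^∞(ℝ), let n ≥ 2, and let x_1, …, x_n be nonzero real numbers such that there exists k ∈ {1, …, n−1} with x_k x_n < 0 (i.e. x_k and x_n have opposite signs). Then |f'{x_1, …, x_n}| ≤ |f'{x_1, …, x_{k−1}, x_{k+1}, …, x_n}| + |f'{x_1, …, x_{n−1}}|, where the first term on the right omits the argument x_k and the second omits x_n. -/

import Mathlib

open MeasureTheory

/-- Divided difference of order `n-1` of `f` at the `n` points `x`, defined via the
integral formula over the simplex (and set to `0` for the empty tuple). -/
noncomputable def divDiff (f : ℝ → ℝ) : {n : ℕ} → (Fin n → ℝ) → ℝ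
  | 0, _ => 0
  | m + 1, x =>
    ∫ t in {t : Fin m → ℝ | Monotone t ∧ ∀ j, t j ∈ Set.Icc (0 : ℝ) 1},
      iteratedDeriv m f (x (Fin.last m) + ∑ j : Fin m, (x j.castSucc - x j.succ) * t j)

/-- Weighted divided difference `f'{x_1,…,x_n} = (−1)^n x_1⋯x_n f'[x_1,…,x_n]`. -/
noncomputable def wDivDiff (f : ℝ → ℝ) {n : ℕ} (x : Fin n → ℝ) : ℝ :=
  (-1 : ℝ) ^ n * (∏ j, x j) * divDiff (deriv f) x

/-- The simplex of monotone tuples with entries in `[0, 1]`. -/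
def monoSimplex (m : ℕ) : Set (Fin m → ℝ) :=
  {t | Monotone t ∧ ∀ j, t j ∈ Set.Icc (0 : ℝ) 1}

/-- The point `x_m + ∑ (x_j - x_{j+1}) t_j` at which the integrand of `divDiff` is evaluated. -/
noncomputable def simplexPoint {m : ℕ} (x : Fin (m + 1) → ℝ) (t : Fin m → ℝ) : ℝ :=
  x (Fin.last m) + ∑ j : Fin m, (x j.castSucc - x j.succ) * t j

theorem divDiff_succ (f : ℝ → ℝ) {m : ℕ} (x : Fin (m + 1) → ℝ) :
    divDiff f x = ∫ t in monoSimplex m, iteratedDeriv m f (simplexPoint x t) := rfl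

theorem isCompact_monoSimplex (m : ℕ) : IsCompact (monoSimplex m) := by
  have h : IsClosed {t : Fin m → ℝ | Monotone t} := by
    simp only [Monotone, Set.ofPred_forall]
    refine isClosed_iInter fun i => isClosed_iInter fun j => isClosed_iInter fun _ => ?_
    exact isClosed_le (continuous_apply i) (continuous_apply j)
  have h2 : IsCompact (Set.univ.pi fun _ : Fin m => Set.Icc (0 : ℝ) 1) :=
    isCompact_univ_pi fun _ => isCompact_Icc
  convert h2.inter_left h using 1
  ext t
  simp only [monoSimplex, Set.mem_ofPred_eq, Set.mem_inter_iff, Set.mem_univ_pi]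

theorem simplexPoint_eq_sum {m : ℕ} (x : Fin (m + 1) → ℝ) (t : Fin m → ℝ) :
    simplexPoint x t = ∑ i, x i * ((Fin.snoc t 1 : Fin (m + 1) → ℝ) i -
      (Fin.cons 0 t : Fin (m + 1) → ℝ) i) := by
  simp only [mul_sub, Finset.sum_sub_distrib]
  rw [Fin.sum_univ_castSucc, Fin.sum_univ_succ (fun i => x i * (Fin.cons 0 t : Fin (m + 1) → ℝ) i)]
  simp only [simplexPoint, Fin.snoc_castSucc, Fin.snoc_last, Fin.cons_zero, Fin.cons_succ, sub_mul,
    Finset.sum_sub_distrib]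
  ring

theorem snoc_one_apply {m : ℕ} (u : Fin m → ℝ) (i : Fin (m + 1)) :
    (Fin.snoc u 1 : Fin (m + 1) → ℝ) i = if h : (i : ℕ) < m then u ⟨i, h⟩ else 1 := by
  induction i using Fin.lastCases <;> simp

theorem cons_zero_apply {m : ℕ} (u : Fin m → ℝ) (i : Fin (m + 1)) :
    (Fin.cons 0 u : Fin (m + 1) → ℝ) i =
      if h : (i : ℕ) = 0 then 0 else u ⟨i - 1, by omega⟩ := by
  induction i using Fin.cases <;> simp

theorem insertNth_real_apply {m : ℕ} (j : Fin (m + 1)) (s : ℝ) (u : Fin m → ℝ) (i : Fin (m + 1)) :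
    (j.insertNth s u : Fin (m + 1) → ℝ) i =
      if h : (i : ℕ) < j then u ⟨i, by omega⟩
      else if h' : (i : ℕ) = j then s else u ⟨i - 1, by omega⟩ := by
  induction i using j.succAboveCases with
  | x => simp
  | p i =>
    rw [Fin.insertNth_apply_succAbove]
    rcases lt_or_ge i.castSucc j with h | h
    · have h1 : (i : ℕ) < j := h
      rw [Fin.succAbove_of_castSucc_lt _ _ h]
      simp [h1]
    · have h1 : (j : ℕ) ≤ i := h
      rw [Fin.succAbove_of_le_castSucc _ _ h]
      have h2 : ¬ ((i : ℕ) + 1 < j) := by omega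
      have h3 : ¬ ((i : ℕ) + 1 = j) := by omega
      simp [h2, h3]

theorem succAbove_val {m : ℕ} (p : Fin (m + 1)) (i : Fin m) :
    (p.succAbove i : ℕ) = if (i : ℕ) < p then (i : ℕ) else i + 1 := by
  rcases lt_or_ge i.castSucc p with h | h
  · rw [Fin.succAbove_of_castSucc_lt _ _ h, if_pos (show (i : ℕ) < p from h)]; rfl
  · rw [Fin.succAbove_of_le_castSucc _ _ h, if_neg (not_lt.2 (show (p : ℕ) ≤ i from h))]; rfl

theorem simplexPoint_insertNth_snoc {m : ℕ} (x : Fin (m + 2) → ℝ) (j : Fin (m + 1))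
    (u : Fin m → ℝ) :
    simplexPoint x (j.insertNth ((Fin.snoc u 1 : Fin (m + 1) → ℝ) j) u) =
      simplexPoint (j.succ.removeNth x) u := by
  rw [simplexPoint_eq_sum, simplexPoint_eq_sum, Fin.sum_univ_succAbove _ j.succ]
  have h0 : (Fin.snoc (j.insertNth ((Fin.snoc u 1 : Fin (m + 1) → ℝ) j) u : Fin (m + 1) → ℝ) 1 :
      Fin (m + 2) → ℝ) j.succ -
      (Fin.cons 0 (j.insertNth ((Fin.snoc u 1 : Fin (m + 1) → ℝ) j) u : Fin (m + 1) → ℝ) :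
      Fin (m + 2) → ℝ) j.succ = 0 := by
    simp only [snoc_one_apply, cons_zero_apply, insertNth_real_apply, Fin.val_succ]
    grind
  rw [h0, mul_zero, zero_add]
  refine Finset.sum_congr rfl fun i _ => ?_
  simp only [Fin.removeNth]
  congr 1
  simp only [snoc_one_apply, cons_zero_apply, insertNth_real_apply, succAbove_val, Fin.val_succ]
  congr 1 <;> grind

theorem simplexPoint_insertNth_cons {m : ℕ} (x : Fin (m + 2) → ℝ) (j : Fin (m + 1))
    (u : Fin m → ℝ) :
    simplexPoint x (j.insertNth ((Fin.cons 0 u : Fin (m + 1) → ℝ) j) u) =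
      simplexPoint (j.castSucc.removeNth x) u := by
  rw [simplexPoint_eq_sum, simplexPoint_eq_sum, Fin.sum_univ_succAbove _ j.castSucc]
  have h0 : (Fin.snoc (j.insertNth ((Fin.cons 0 u : Fin (m + 1) → ℝ) j) u : Fin (m + 1) → ℝ) 1 :
      Fin (m + 2) → ℝ) j.castSucc -
      (Fin.cons 0 (j.insertNth ((Fin.cons 0 u : Fin (m + 1) → ℝ) j) u : Fin (m + 1) → ℝ) :
      Fin (m + 2) → ℝ) j.castSucc = 0 := by
    simp only [snoc_one_apply, cons_zero_apply, insertNth_real_apply, Fin.val_castSucc]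
    grind
  rw [h0, mul_zero, zero_add]
  refine Finset.sum_congr rfl fun i _ => ?_
  simp only [Fin.removeNth]
  congr 1
  simp only [snoc_one_apply, cons_zero_apply, insertNth_real_apply, succAbove_val,
    Fin.val_castSucc]
  congr 1 <;> grind

theorem cons_zero_le_snoc_one {m : ℕ} {u : Fin m → ℝ} (hu : u ∈ monoSimplex m)
    (j : Fin (m + 1)) :
    (Fin.cons 0 u : Fin (m + 1) → ℝ) j ≤ (Fin.snoc u 1 : Fin (m + 1) → ℝ) j := by
  obtain ⟨hm, hI⟩ := hu
  rw [snoc_one_apply, cons_zero_apply]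
  split_ifs
  · exact (hI _).1
  · exact zero_le_one
  · exact hm (Fin.mk_le_mk.2 (by omega))
  · exact (hI _).2

theorem insertNth_mem_monoSimplex {m : ℕ} (j : Fin (m + 1)) (s : ℝ) (u : Fin m → ℝ) :
    (j.insertNth s u : Fin (m + 1) → ℝ) ∈ monoSimplex (m + 1) ↔
      u ∈ monoSimplex m ∧ s ∈ Set.Icc ((Fin.cons 0 u : Fin (m + 1) → ℝ) j)
        ((Fin.snoc u 1 : Fin (m + 1) → ℝ) j) := by
  rw [snoc_one_apply, cons_zero_apply]
  constructor
  · rintro ⟨hm, hI⟩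
    have hs := hI j
    rw [Fin.insertNth_apply_same] at hs
    refine ⟨⟨fun a b hab => ?_, fun i => ?_⟩, ?_, ?_⟩
    · simpa using hm ((Fin.strictMono_succAbove j).monotone hab)
    · simpa using hI (j.succAbove i)
    · split_ifs with h
      · exact hs.1
      · have := @hm ⟨j - 1, by omega⟩ j (Fin.mk_le_of_le_val (by omega))
        rw [insertNth_real_apply _ _ _ ⟨j - 1, by omega⟩, dif_pos (Nat.sub_lt (by omega) one_pos),
          Fin.insertNth_apply_same] at this
        exact this
    · split_ifs with h
      · have := @hm j ⟨j + 1, by omega⟩ (Fin.le_def.2 (by simp))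
        rw [insertNth_real_apply _ _ _ ⟨j + 1, by omega⟩, dif_neg (by simp),
          dif_neg (by simp), Fin.insertNth_apply_same] at this
        simpa using this
      · exact hs.2
  · rintro ⟨⟨hm, hI⟩, h1, h2⟩
    have hlo : ∀ i : Fin m, (i : ℕ) < j → u i ≤ s := by
      intro i hi
      rw [dif_neg (by omega)] at h1
      exact (hm (Fin.le_def.2 (by simp; omega))).trans h1
    have hhi : ∀ i : Fin m, (j : ℕ) ≤ i → s ≤ u i := by
      intro i hi
      rw [dif_pos (by omega)] at h2
      exact h2.trans (hm (Fin.le_def.2 hi))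
    constructor
    · intro a b hab
      have hab' : (a : ℕ) ≤ b := hab
      rw [insertNth_real_apply, insertNth_real_apply]
      split_ifs <;> first
        | exact le_rfl
        | (apply hlo; simp; omega)
        | (apply hhi; simp; omega)
        | (apply hm; simp; omega)
    · intro i
      rw [insertNth_real_apply]
      split_ifs
      · exact hI _
      · constructor
        · split_ifs at h1
          · exact h1
          · exact (hI _).1.trans h1
        · split_ifs at h2
          · exact h2.trans (hI _).2
          · exact h2
      · exact hI _

theorem continuous_simplexPoint {m : ℕ} (x : Fin (m + 1) → ℝ) : Continuous (simplexPoint x) := by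
  unfold simplexPoint
  fun_prop

/-- Integration over the simplex by first integrating out the `j`-th coordinate. -/
theorem setIntegral_monoSimplex_succ {m : ℕ} (j : Fin (m + 1)) {G : (Fin (m + 1) → ℝ) → ℝ}
    (hG : Continuous G) :
    ∫ t in monoSimplex (m + 1), G t = ∫ u in monoSimplex m,
      ∫ s in (Fin.cons 0 u : Fin (m + 1) → ℝ) j..(Fin.snoc u 1 : Fin (m + 1) → ℝ) j,
        G (j.insertNth s u) := by
  have hS := (isCompact_monoSimplex (m + 1)).measurableSet
  have hmp := (volume_preserving_piFinSuccAbove (fun _ : Fin (m + 1) => ℝ) j).symm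
  have hint : Integrable ((monoSimplex (m + 1)).indicator G) :=
    (integrable_indicator_iff hS).2
      (hG.continuousOn.integrableOn_compact (isCompact_monoSimplex (m + 1)))
  have hint' := (hmp.integrable_comp_emb (MeasurableEquiv.measurableEmbedding _)).2 hint
  rw [← integral_indicator hS, ← hmp.integral_comp (MeasurableEquiv.measurableEmbedding _),
    ← integral_indicator (isCompact_monoSimplex m).measurableSet]
  have hprod := integral_prod_symm _ hint'
  refine hprod.trans (integral_congr_ae (Filter.Eventually.of_forall fun u => ?_))
  have key : ∀ s : ℝ, ((monoSimplex (m + 1)).indicator G ∘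
      (MeasurableEquiv.piFinSuccAbove (fun _ : Fin (m + 1) => ℝ) j).symm) (s, u) =
      (monoSimplex (m + 1)).indicator G (j.insertNth s u) := fun s => rfl
  simp only [key]
  by_cases hu : u ∈ monoSimplex m
  · rw [Set.indicator_of_mem hu,
      intervalIntegral.integral_of_le (cons_zero_le_snoc_one hu j),
      ← integral_Icc_eq_integral_Ioc, ← integral_indicator measurableSet_Icc]
    refine integral_congr_ae (Filter.Eventually.of_forall fun s => ?_)
    simp only [Set.indicator, insertNth_mem_monoSimplex, hu, true_and]
  · rw [Set.indicator_of_notMem hu]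
    simp [insertNth_mem_monoSimplex, hu]

theorem divDiff_adjacent {f : ℝ → ℝ} (hf : ContDiff ℝ (⊤ : ℕ∞) f) {m : ℕ}
    (x : Fin (m + 2) → ℝ) (j : Fin (m + 1)) :
    (x j.castSucc - x j.succ) * divDiff f x =
      divDiff f (j.succ.removeNth x) - divDiff f (j.castSucc.removeNth x) := by
  have hc : ∀ k, Continuous (iteratedDeriv k f) := fun k =>
    hf.continuous_iteratedDeriv k (by exact_mod_cast le_top)
  have hd : ∀ y, HasDerivAt (iteratedDeriv m f) (iteratedDeriv (m + 1) f y) y := fun y => by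
    rw [iteratedDeriv_succ]
    exact (hf.differentiable_iteratedDeriv m (by exact_mod_cast ENat.natCast_lt_top m) y).hasDerivAt
  have hi : ∀ y : Fin (m + 1) → ℝ,
      IntegrableOn (fun u => iteratedDeriv m f (simplexPoint y u)) (monoSimplex m) := fun y =>
    ((hc m).comp (continuous_simplexPoint y)).continuousOn.integrableOn_compact
      (isCompact_monoSimplex m)
  rw [divDiff_succ, divDiff_succ, divDiff_succ, ← integral_sub (hi _) (hi _),
    setIntegral_monoSimplex_succ j (G := fun t => iteratedDeriv (m + 1) f (simplexPoint x t))
      ((hc (m + 1)).comp (continuous_simplexPoint x)),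
    ← integral_const_mul]
  refine integral_congr_ae (Filter.Eventually.of_forall fun u => ?_)
  simp only
  rw [← intervalIntegral.integral_const_mul, ← simplexPoint_insertNth_snoc,
    ← simplexPoint_insertNth_cons]
  have hE : ∀ s, HasDerivAt (fun s => simplexPoint x (j.insertNth s u))
      (x j.castSucc - x j.succ) s := fun s => by
    simp only [simplexPoint, Fin.sum_univ_succAbove _ j, Fin.insertNth_apply_same,
      Fin.insertNth_apply_succAbove]
    refine HasDerivAt.const_add _ (HasDerivAt.add_const _ ?_)
    exact hasDerivAt_const_mul _
  have hEc : Continuous fun s => simplexPoint x (j.insertNth s u) :=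
    continuous_iff_continuousAt.2 fun s => (hE s).continuousAt
  refine intervalIntegral.integral_eq_sub_of_hasDerivAt
    (f := fun s => iteratedDeriv m f (simplexPoint x (j.insertNth s u))) (fun s _ => ?_) ?_
  · rw [mul_comm]
    exact (hd _).comp s (hE s)
  · exact (((hc (m + 1)).comp hEc).const_mul _).intervalIntegrable _ _

theorem divDiff_sub_last {f : ℝ → ℝ} (hf : ContDiff ℝ (⊤ : ℕ∞) f) {m : ℕ}
    (x : Fin (m + 2) → ℝ) (k : Fin (m + 2)) :
    (x k - x (Fin.last (m + 1))) * divDiff f x =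
      divDiff f ((Fin.last (m + 1)).removeNth x) - divDiff f (k.removeNth x) := by
  induction k using Fin.reverseInduction with
  | last => simp
  | cast j ih => linear_combination ih + divDiff_adjacent hf x j

/-- for smooth `f`, `n ≥ 2` points, all nonzero, such that some
`x_k` (with `k` not the last index) has opposite sign to `x_n`, one has
`|f'{x_1,…,x_n}| ≤ |f'{x_1,…,x_{k−1},x_{k+1},…,x_n}| + |f'{x_1,…,x_{n−1}}|`.
Here the number of points is `n + 2`. -/
theorem statement17 (f : ℝ → ℝ) (hf : ContDiff ℝ (⊤ : ℕ∞) f) (n : ℕ)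
    (x : Fin (n + 2) → ℝ) (hx0 : ∀ j, x j ≠ 0) (k : Fin (n + 1))
    (hsign : x k.castSucc * x (Fin.last (n + 1)) < 0) :
    |wDivDiff f x| ≤
      |wDivDiff f (Fin.removeNth k.castSucc x)| +
        |wDivDiff f (x ∘ Fin.castSucc)| := by
  have hg : ContDiff ℝ (⊤ : ℕ∞) (deriv f) := (contDiff_infty_iff_deriv.1 hf).2
  have hD := divDiff_sub_last hg x k.castSucc
  have hlast : x ∘ Fin.castSucc = (Fin.last (n + 1)).removeNth x := by
    funext i
    simp [Fin.removeNth]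
  rw [hlast]
  have hw : ∀ p : Fin (n + 2), |∏ j, x j| * |divDiff (deriv f) (p.removeNth x)| =
      |x p| * |wDivDiff f (p.removeNth x)| := fun p => by
    rw [Fin.prod_univ_succAbove _ p]
    simp only [wDivDiff, abs_mul, abs_pow, abs_neg, abs_one, one_pow, one_mul, Fin.removeNth,
      mul_assoc]
  have hx : |wDivDiff f x| = |∏ j, x j| * |divDiff (deriv f) x| := by
    simp [wDivDiff, abs_mul]
  have hk := hw k.castSucc
  have hl := hw (Fin.last (n + 1))
  have habs : |x k.castSucc - x (Fin.last (n + 1))| =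
      |x k.castSucc| + |x (Fin.last (n + 1))| := by
    rcases mul_neg_iff.1 hsign with ⟨h1, h2⟩ | ⟨h1, h2⟩
    · rw [abs_of_pos h1, abs_of_neg h2, abs_of_pos (by linarith)]; ring
    · rw [abs_of_neg h1, abs_of_pos h2, abs_of_neg (by linarith)]; ring
  have ha := abs_pos.2 (hx0 k.castSucc)
  have hb := abs_pos.2 (hx0 (Fin.last (n + 1)))
  have hle := mul_le_mul_of_nonneg_left
    (abs_sub (divDiff (deriv f) ((Fin.last (n + 1)).removeNth x))
      (divDiff (deriv f) (k.castSucc.removeNth x))) (abs_nonneg (∏ j, x j))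
  rw [← hD, abs_mul, habs, mul_add, hk, hl] at hle
  refine le_of_mul_le_mul_left ?_ (add_pos ha hb)
  have h1 := mul_nonneg ha.le (abs_nonneg (wDivDiff f ((Fin.last (n + 1)).removeNth x)))
  have h2 := mul_nonneg hb.le (abs_nonneg (wDivDiff f (k.castSucc.removeNth x)))
  rw [hx]
  linarith
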